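/- Assume in addition that h is continuous at s_*, and suppose there exists t_* ∈ [0, s_*) such that ∫_{t_*}^{s_*} (h(s_*) − h(t)) dt ≥ 0. Then every Carathéodory solution y on [0, s_*] of the ODE with parameter c = h(s_*) and y(0) = 0 satisfies y(s_*) > 0; consequently, the boundary value problem on [0, s_*] admits no positive solution for c = h(s_*). -/

import Mathlib

open MeasureTheory Set Filter Topology intervalIntegral

noncomputable section

/-- A Carathéodory solution on `[a,b]` of the ODE
`y'(t) = p' * ((c - h t) * (y⁺ t)^(1/p) - f t)`, in integral form. -/
def IsCaraSol (p p' : ℝ) (h f : ℝ → ℝ) (c a b : ℝ) (y : ℝ → ℝ) : Prop :=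
  ContinuousOn y (Set.Icc a b) ∧
  ∀ t ∈ Set.Icc a b,
    y t = y a + ∫ u in a..t, p' * ((c - h u) * (max (y u) 0) ^ (1 / p) - f u)

/-- A positive solution of the boundary value problem on `[a,b]`. -/
def IsPosBVPSol (p p' : ℝ) (h f : ℝ → ℝ) (c a b : ℝ) (y : ℝ → ℝ) : Prop :=
  IsCaraSol p p' h f c a b y ∧ y a = 0 ∧ y b = 0 ∧ ∀ t ∈ Set.Ioo a b, 0 < y t
/-- Post-composing an absolutely continuous function with a Lipschitz map preserves absolute
continuity. -/
theorem LipschitzOnWith.comp_absolutelyContinuousOnInterval {φ f : ℝ → ℝ} {K : NNReal}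
    {a b : ℝ} {t : Set ℝ} (hφ : LipschitzOnWith K φ t) (hf : AbsolutelyContinuousOnInterval f a b)
    (hmaps : MapsTo f (uIcc a b) t) : AbsolutelyContinuousOnInterval (φ ∘ f) a b := by
  rw [absolutelyContinuousOnInterval_iff] at hf ⊢
  intro ε hε
  obtain ⟨δ, hδ, H⟩ := hf (ε / (K + 1)) (by positivity)
  refine ⟨δ, hδ, fun E hE hlen ↦ ?_⟩
  calc ∑ i ∈ Finset.range E.1, dist ((φ ∘ f) (E.2 i).1) ((φ ∘ f) (E.2 i).2)
      ≤ ∑ i ∈ Finset.range E.1, (K + 1) * dist (f (E.2 i).1) (f (E.2 i).2) := by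
        refine Finset.sum_le_sum fun i hi ↦ ?_
        refine (hφ.dist_le_mul _ (hmaps (hE.1 i hi).1) _ (hmaps (hE.1 i hi).2)).trans ?_
        gcongr
        simp
    _ = (K + 1) * ∑ i ∈ Finset.range E.1, dist (f (E.2 i).1) (f (E.2 i).2) := by
        rw [Finset.mul_sum]
    _ < (K + 1) * (ε / (K + 1)) := by gcongr; exact H E hE hlen
    _ = ε := by field

/-- Chain rule and fundamental theorem of calculus for `φ ∘ y`, where `y` is a primitive of an
integrable function `g` and `φ` is `C^1` along the range of `y`. -/
theorem integral_deriv_comp_mul_eq_sub {φ y g : ℝ → ℝ} {a b : ℝ} (hab : a ≤ b)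
    (hg : IntervalIntegrable g volume a b)
    (hy : ∀ t ∈ Icc a b, y t = y a + ∫ u in a..t, g u)
    (hφ : ∀ t ∈ Icc a b, ContDiffAt ℝ 1 φ (y t)) :
    IntervalIntegrable (fun t ↦ deriv φ (y t) * g t) volume a b ∧
      ∫ t in a..b, deriv φ (y t) * g t = φ (y b) - φ (y a) := by
  set Y : ℝ → ℝ := fun t ↦ y a + ∫ u in a..t, g u with hY
  have hYac : AbsolutelyContinuousOnInterval Y a b := by
    have hc : AbsolutelyContinuousOnInterval (fun _ : ℝ ↦ y a) a b :=
      (LipschitzWith.const (y a)).lipschitzOnWith.absolutelyContinuousOnInterval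
    exact hc.add (hg.absolutelyContinuousOnInterval_intervalIntegral (c := a) (by simp))
  have hYc : ContinuousOn Y (Icc a b) := by simpa [uIcc_of_le hab] using hYac.continuousOn
  have hYφ : ∀ t ∈ Icc a b, ContDiffAt ℝ 1 φ (Y t) := fun t ht ↦ by
    simpa only [hy t ht] using hφ t ht
  have hrange : Y '' Icc a b = Icc (sInf (Y '' Icc a b)) (sSup (Y '' Icc a b)) :=
    hYc.image_Icc hab
  obtain ⟨K, hK⟩ : ∃ K, LipschitzOnWith K φ (Y '' Icc a b) := by
    refine ContDiffOn.exists_lipschitzOnWith (n := 1) ?_ (by decide) ?_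
      (isCompact_Icc.image_of_continuousOn hYc)
    · rintro _ ⟨t, ht, rfl⟩
      exact (hYφ t ht).contDiffWithinAt
    · rw [hrange]
      exact convex_Icc _ _
  have hcomp : AbsolutelyContinuousOnInterval (φ ∘ Y) a b :=
    hK.comp_absolutelyContinuousOnInterval hYac (by
      rw [uIcc_of_le hab]
      exact mapsTo_image _ _)
  have hderiv : ∀ᵐ t, t ∈ uIoc a b → deriv (φ ∘ Y) t = deriv φ (y t) * g t := by
    filter_upwards [hg.ae_hasDerivAt_integral] with t ht htab
    have htI : t ∈ Icc a b := by
      rw [← uIcc_of_le hab]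
      exact uIoc_subset_uIcc htab
    have h1 : HasDerivAt Y (g t) t := (ht (uIoc_subset_uIcc htab) a (by simp)).const_add (y a)
    have h2 := ((hYφ t htI).differentiableAt (by simp)).hasDerivAt
    rw [(h2.comp t h1).deriv, hy t htI]
  refine ⟨hcomp.intervalIntegrable_deriv.congr_ae ?_, ?_⟩
  · exact (ae_restrict_iff' measurableSet_uIoc).2 hderiv
  · rw [← integral_congr_ae hderiv, hcomp.integral_deriv_eq_sub]
    simp only [Function.comp_apply, hy b (right_mem_Icc.2 hab), hY, integral_same, add_zero]

/-- A function continuous on a closed interval and strictly monotone on its interior takes a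
strictly larger value at the right endpoint. -/
theorem lt_of_strictMonoOn_Ioo {W : ℝ → ℝ} {a b : ℝ} (hab : a < b)
    (hW : ContinuousOn W (Icc a b)) (hmono : StrictMonoOn W (Ioo a b)) : W a < W b := by
  obtain ⟨u, hau, hub⟩ := exists_between hab
  obtain ⟨v, huv, hvb⟩ := exists_between hub
  have hla : W a ≤ W u := by
    have hlim : Tendsto W (𝓝[>] a) (𝓝 (W a)) :=
      (hW a (left_mem_Icc.2 hab.le)).mono_left
        ((nhdsWithin_Ioo_eq_nhdsGT hab) ▸ nhdsWithin_mono _ Ioo_subset_Icc_self)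
    refine le_of_tendsto hlim ?_
    filter_upwards [Ioo_mem_nhdsGT hau] with x hx
    exact (hmono ⟨hx.1, hx.2.trans hub⟩ ⟨hau, hub⟩ hx.2).le
  have hlb : W v ≤ W b := by
    have hlim : Tendsto W (𝓝[<] b) (𝓝 (W b)) :=
      (hW b (right_mem_Icc.2 hab.le)).mono_left
        ((nhdsWithin_Ioo_eq_nhdsLT hab) ▸ nhdsWithin_mono _ Ioo_subset_Icc_self)
    refine ge_of_tendsto hlim ?_
    filter_upwards [Ioo_mem_nhdsLT hvb] with x hx
    exact (hmono ⟨hau.trans huv, hvb⟩ ⟨(hau.trans huv).trans hx.1, hx.2⟩ hx.1).le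
  exact hla.trans_lt ((hmono ⟨hau, hub⟩ ⟨hau.trans huv, hvb⟩ huv).trans_le hlb)

/-- The right-hand side of the ODE is integrable along a continuous function. -/
theorem intervalIntegrable_rhs {p p' c s : ℝ} {h f y : ℝ → ℝ} (hp : 0 < p) (hs : 0 ≤ s)
    (hh : IntervalIntegrable (fun u ↦ c - h u) volume 0 s)
    (hf : IntervalIntegrable f volume 0 s) (hy : ContinuousOn y (Icc 0 s)) :
    IntervalIntegrable (fun u ↦ p' * ((c - h u) * (max (y u) 0) ^ (1 / p) - f u)) volume 0 s := by
  refine ((hh.mul_continuousOn ?_).sub hf).const_mul p'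
  rw [uIcc_of_le hs]
  exact (hy.sup continuousOn_const).rpow_const fun t _ ↦ Or.inr (by positivity)

namespace IsCaraSol

variable {p p' c s : ℝ} {h f y : ℝ → ℝ}

theorem eq_add_integral (hy : IsCaraSol p p' h f c 0 s y)
    (hg : IntervalIntegrable (fun u ↦ p' * ((c - h u) * (max (y u) 0) ^ (1 / p) - f u)) volume 0 s)
    {a b : ℝ} (ha : a ∈ Icc 0 s) (hb : b ∈ Icc 0 s) :
    y b = y a + ∫ u in a..b, p' * ((c - h u) * (max (y u) 0) ^ (1 / p) - f u) := by
  have hsub : ∀ t ∈ Icc 0 s, IntervalIntegrable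
      (fun u ↦ p' * ((c - h u) * (max (y u) 0) ^ (1 / p) - f u)) volume 0 t := fun t ht ↦
    hg.mono_set (by
      rw [uIcc_of_le ht.1, uIcc_of_le (ht.1.trans ht.2)]
      exact Icc_subset_Icc_right ht.2)
  rw [hy.2 b hb, hy.2 a ha, add_assoc,
    integral_add_adjacent_intervals (hsub a ha) ((hsub a ha).symm.trans (hsub b hb))]

theorem nonneg (hy : IsCaraSol p p' h f c 0 s y)
    (hg : IntervalIntegrable (fun u ↦ p' * ((c - h u) * (max (y u) 0) ^ (1 / p) - f u)) volume 0 s)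
    (hp : 0 < p) (hp' : 0 < p') (hfneg : ∀ t ∈ Ioo 0 s, f t < 0) (hy0 : y 0 = 0)
    {t : ℝ} (ht : t ∈ Icc 0 s) : 0 ≤ y t := by
  by_contra! hneg
  have hcont : ContinuousOn y (Icc 0 t) := hy.1.mono (Icc_subset_Icc_right ht.2)
  have hcompact : IsCompact (Icc 0 t ∩ y ⁻¹' Ici 0) :=
    isCompact_Icc.of_isClosed_subset
      (hcont.preimage_isClosed_of_isClosed isClosed_Icc isClosed_Ici) inter_subset_left
  obtain ⟨r, ⟨hr, hyr⟩, hmax⟩ := hcompact.exists_isGreatest ⟨0, ⟨le_rfl, ht.1⟩, by simp [hy0]⟩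
  have key := hy.eq_add_integral hg ⟨hr.1, hr.2.trans ht.2⟩ ht
  have hint : 0 ≤ ∫ u in r..t, p' * ((c - h u) * (max (y u) 0) ^ (1 / p) - f u) := by
    rw [integral_of_le hr.2, integral_Ioc_eq_integral_Ioo]
    refine setIntegral_nonneg measurableSet_Ioo fun u hu ↦ ?_
    have hyu : y u < 0 := by
      by_contra! hyu
      exact hu.1.not_ge (hmax ⟨⟨hr.1.trans hu.1.le, hu.2.le⟩, hyu⟩)
    have hfu := hfneg u ⟨hr.1.trans_lt hu.1, hu.2.trans_le ht.2⟩
    rw [max_eq_right hyu.le, Real.zero_rpow (by positivity)]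
    exact mul_nonneg hp'.le (by linarith)
  have : 0 ≤ y r := hyr
  linarith

theorem pos (hy : IsCaraSol p p' h f c 0 s y)
    (hg : IntervalIntegrable (fun u ↦ p' * ((c - h u) * (max (y u) 0) ^ (1 / p) - f u)) volume 0 s)
    (hp : 0 < p) (hp' : 0 < p') (hfneg : ∀ t ∈ Ioo 0 s, f t < 0) (hy0 : y 0 = 0)
    (husc : UpperSemicontinuousOn f (Ioo 0 s)) {M : ℝ} (hbd : ∀ t ∈ Icc 0 s, |h t| ≤ M)
    {t : ℝ} (ht : t ∈ Ioo 0 s) : 0 < y t := by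
  by_contra! hneg
  have hft := hfneg t ht
  have hM : 0 ≤ M := (abs_nonneg _).trans (hbd t ⟨ht.1.le, ht.2.le⟩)
  have hnhds : Icc 0 s ∈ 𝓝 t := Icc_mem_nhds ht.1 ht.2
  have hf_ev : ∀ᶠ u in 𝓝 t, f u < f t / 2 := by
    have := husc t ht (f t / 2) (by linarith)
    rwa [(isOpen_Ioo.nhdsWithin_eq ht)] at this
  have hy_ev : ∀ᶠ u in 𝓝 t, (|c| + M) * (max (y u) 0) ^ (1 / p) < -f t / 2 := by
    have hct : ContinuousAt (fun u ↦ (|c| + M) * (max (y u) 0) ^ (1 / p)) t :=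
      (((hy.1.continuousAt hnhds).sup continuousAt_const).rpow_const
        (Or.inr (by positivity))).const_mul _
    refine hct.eventually_lt continuousAt_const ?_
    rw [max_eq_right hneg, Real.zero_rpow (by positivity)]
    linarith
  obtain ⟨l, hl, hlsub⟩ := exists_Ioc_subset_of_mem_nhds
    (inter_mem (inter_mem hf_ev hy_ev) hnhds) ⟨t - 1, by linarith⟩
  obtain ⟨r, hlr, hrt⟩ := exists_between hl
  have hrI : r ∈ Icc 0 s := (hlsub ⟨hlr, hrt.le⟩).2
  have htI : t ∈ Icc 0 s := ⟨ht.1.le, ht.2.le⟩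
  have key := hy.eq_add_integral hg hrI htI
  have hint : 0 < ∫ u in r..t, p' * ((c - h u) * (max (y u) 0) ^ (1 / p) - f u) := by
    refine intervalIntegral_pos_of_pos_on (hg.mono_set ?_) (fun u hu ↦ ?_) hrt
    · rw [uIcc_of_le hrt.le, uIcc_of_le (ht.1.trans ht.2).le]
      exact Icc_subset_Icc hrI.1 htI.2
    · obtain ⟨⟨hfu, hyu⟩, huI⟩ := hlsub ⟨hlr.trans hu.1, hu.2.le⟩
      have hfu : f u < f t / 2 := hfu
      have hyu : (|c| + M) * (max (y u) 0) ^ (1 / p) < -f t / 2 := hyu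
      have hpow : 0 ≤ (max (y u) 0) ^ (1 / p) := by positivity
      have hch : -(|c| + M) ≤ c - h u := by
        linarith [neg_abs_le c, le_abs_self (h u), hbd u huI]
      have := mul_le_mul_of_nonneg_right hch hpow
      exact mul_pos hp' (by linarith)
  have := hy.nonneg hg hp hp' hfneg hy0 hrI
  linarith

theorem integral_lt_rpow_sub_rpow (hy : IsCaraSol p p' h f c 0 s y)
    (hg : IntervalIntegrable (fun u ↦ p' * ((c - h u) * (max (y u) 0) ^ (1 / p) - f u)) volume 0 s)
    (hp : 1 < p) (hp' : p' = p / (p - 1)) (hfneg : ∀ t ∈ Ioo 0 s, f t < 0)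
    (hpos : ∀ t ∈ Ioo 0 s, 0 < y t) (hh : IntervalIntegrable (fun u ↦ c - h u) volume 0 s)
    {a b : ℝ} (ha : a ∈ Ioo 0 s) (hb : b ∈ Ioo 0 s) (hab : a < b) :
    ∫ u in a..b, (c - h u) < y b ^ (1 - 1 / p) - y a ^ (1 - 1 / p) := by
  have hsub : Icc a b ⊆ Ioo 0 s := Icc_subset_Ioo ha.1 hb.2
  have hsub' : uIcc a b ⊆ uIcc 0 s := by
    rw [uIcc_of_le hab.le, uIcc_of_le (ha.1.trans ha.2).le]
    exact hsub.trans Ioo_subset_Icc_self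
  obtain ⟨hint, hval⟩ := integral_deriv_comp_mul_eq_sub (φ := fun x ↦ x ^ (1 - 1 / p)) hab.le
    (hg.mono_set hsub')
    (fun t ht ↦ hy.eq_add_integral hg (Ioo_subset_Icc_self ha) (Ioo_subset_Icc_self (hsub ht)))
    (fun t ht ↦ Real.contDiffAt_rpow_const_of_ne (hpos t (hsub ht)).ne')
  have hdiff : 0 < ∫ u in a..b, (deriv (fun x : ℝ ↦ x ^ (1 - 1 / p)) (y u) *
      (p' * ((c - h u) * (max (y u) 0) ^ (1 / p) - f u)) - (c - h u)) := by
    refine intervalIntegral_pos_of_pos_on (hint.sub (hh.mono_set hsub')) (fun u hu ↦ ?_) hab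
    have huI := hsub (Ioo_subset_Icc_self hu)
    have hyu := hpos u huI
    have hpow : 0 < y u ^ (1 / p) := by positivity
    have hmul : y u ^ (-(1 / p)) = (y u ^ (1 / p))⁻¹ := Real.rpow_neg hyu.le _
    have hcoef : (1 - 1 / p) * p' = 1 := by
      have : p - 1 ≠ 0 := by linarith
      rw [hp']
      field
    rw [Real.deriv_rpow_const, max_eq_left hyu.le, show 1 - 1 / p - 1 = -(1 / p) by ring, hmul]
    have : (1 - 1 / p) * (y u ^ (1 / p))⁻¹ * (p' * ((c - h u) * y u ^ (1 / p) - f u)) - (c - h u)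
        = -f u * (y u ^ (1 / p))⁻¹ := by
      calc _ = ((1 - 1 / p) * p') * ((c - h u) * (y u ^ (1 / p) * (y u ^ (1 / p))⁻¹)
            - f u * (y u ^ (1 / p))⁻¹) - (c - h u) := by ring
        _ = _ := by rw [hcoef, mul_inv_cancel₀ hpow.ne']; ring
    rw [this]
    exact mul_pos (neg_pos.2 (hfneg u huI)) (inv_pos.2 hpow)
  rw [integral_sub hint (hh.mono_set hsub'), hval] at hdiff
  linarith

end IsCaraSol

theorem stmt_19
    (p p' s : ℝ) (h f : ℝ → ℝ)
    (hp : 1 < p) (hp'def : p' = p / (p - 1))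
    (hs : s ∈ Set.Ioo (0:ℝ) 1)
    (hmeas : Measurable h)
    (hbd : ∃ M : ℝ, ∀ t ∈ Set.Icc (0:ℝ) 1, |h t| ≤ M)
    (hfint : MeasureTheory.IntegrableOn f (Set.Ioo (0:ℝ) 1))
    (hf0 : f 0 = 0) (hfs : f s = 0) (hf1 : f 1 = 0)
    (hfneg : ∀ t ∈ Set.Ioo (0:ℝ) s, f t < 0)
    (hfpos : ∀ t ∈ Set.Ioo s (1:ℝ), 0 < f t)
    (husc : UpperSemicontinuousOn f (Set.Ioo (0:ℝ) s))
    (hlsc : LowerSemicontinuousOn f (Set.Ioo s (1:ℝ)))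
    (hhc : ContinuousAt h s)
    (ht : ∃ t₀ ∈ Set.Ico (0:ℝ) s, 0 ≤ ∫ t in t₀..s, (h s - h t)) :
    (∀ y, IsCaraSol p p' h f (h s) 0 s y → y 0 = 0 → 0 < y s) ∧
    ¬ ∃ y, IsPosBVPSol p p' h f (h s) 0 s y := by
  obtain ⟨M, hM⟩ := hbd
  obtain ⟨t₀, ht₀, hint⟩ := ht
  have hp'pos : 0 < p' := by
    rw [hp'def]
    exact div_pos (by linarith) (by linarith)
  have hbd : ∀ t ∈ Icc 0 s, |h t| ≤ M := fun t ht ↦ hM t ⟨ht.1, ht.2.trans hs.2.le⟩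
  have hf : IntervalIntegrable f volume 0 s := by
    rw [intervalIntegrable_iff_integrableOn_Ioo_of_le hs.1.le]
    exact hfint.mono_set (Ioo_subset_Ioo_right hs.2.le)
  have hh : IntervalIntegrable (fun u ↦ h s - h u) volume 0 s := by
    refine intervalIntegrable_const.sub ?_
    rw [intervalIntegrable_iff_integrableOn_Icc_of_le hs.1.le]
    exact Measure.integrableOn_of_bounded (M := M) (by simp) hmeas.aestronglyMeasurable
      ((ae_restrict_iff' measurableSet_Icc).2 (ae_of_all _ hbd))
  have main : ∀ y, IsCaraSol p p' h f (h s) 0 s y → y 0 = 0 → 0 < y s := by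
    intro y hy hy0
    have hg := intervalIntegrable_rhs (p := p) (p' := p') (by linarith) hs.1.le hh hf hy.1
    have hnonneg : ∀ t ∈ Icc 0 s, 0 ≤ y t := fun t ht ↦
      hy.nonneg hg (by linarith) hp'pos hfneg hy0 ht
    have hpos : ∀ t ∈ Ioo 0 s, 0 < y t := fun t ht ↦
      hy.pos hg (by linarith) hp'pos hfneg hy0 husc hbd ht
    have hexp : 0 < 1 - 1 / p := by
      rw [sub_pos, div_lt_one (by linarith)]
      exact hp
    have hsub : Icc t₀ s ⊆ Icc 0 s := Icc_subset_Icc_left ht₀.1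
    have hh' : ∀ t ∈ Icc t₀ s, IntervalIntegrable (fun u ↦ h s - h u) volume t₀ t := fun t ht ↦
      hh.mono_set (by
        rw [uIcc_of_le ht.1, uIcc_of_le hs.1.le]
        exact Icc_subset_Icc ht₀.1 ht.2)
    have hWc : ContinuousOn (fun t ↦ y t ^ (1 - 1 / p) - ∫ u in t₀..t, (h s - h u)) (Icc t₀ s) := by
      refine ((hy.1.mono hsub).rpow_const fun _ _ ↦ Or.inr hexp.le).sub ?_
      have := continuousOn_primitive_interval'
        (hh' s ⟨ht₀.2.le, le_rfl⟩) (left_mem_uIcc (a := t₀) (b := s))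
      rwa [uIcc_of_le ht₀.2.le] at this
    have hlt := lt_of_strictMonoOn_Ioo ht₀.2 hWc fun a ha b hb hab ↦ by
      have hlt := hy.integral_lt_rpow_sub_rpow hg hp hp'def hfneg hpos hh
        (Ioo_subset_Ioo_left ht₀.1 ha) (Ioo_subset_Ioo_left ht₀.1 hb) hab
      have hadd := integral_interval_sub_left (hh' b ⟨hb.1.le, hb.2.le⟩) (hh' a ⟨ha.1.le, ha.2.le⟩)
      change y a ^ _ - _ < y b ^ _ - _
      linarith
    refine (hnonneg s ⟨hs.1.le, le_rfl⟩).lt_of_ne fun h0 ↦ ?_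
    have hzt : 0 ≤ y t₀ ^ (1 - 1 / p) := Real.rpow_nonneg (hnonneg t₀ ⟨ht₀.1, ht₀.2.le⟩) _
    simp only [← h0, Real.zero_rpow hexp.ne', integral_same] at hlt
    linarith
  exact ⟨main, fun ⟨y, hy, hy0, hys, _⟩ ↦ (main y hy hy0).ne' hys⟩
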